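/- Let k be a field, R a Noetherian local k-algebra, and f ∈ R a nonzerodivisor contained in the maximal ideal of R. Assume that for every finite field extension K of k the ring K ⊗_k (R/(f)) is reduced. Then for every finite field extension K of k the ring K ⊗_k R is reduced; that is, if R/(f) is geometrically reduced over k, then R is geometrically reduced over k. -/

import Mathlib

open TensorProduct

section

variable {k R K : Type*} [Field k] [CommRing R] [Algebra k R] [Field K] [Algebra k K]

/-- Multiplication by `f` on `R`, base changed to `K`, is scalar multiplication by `f`. -/
theorem rTensor_mulLeft_apply (f : R) (y : R ⊗[k] K) :
    (LinearMap.mulLeft k f).rTensor K y = f • y := by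
  induction y with
  | zero => simp
  | tmul a b => simp [TensorProduct.smul_tmul']
  | add a b ha hb => rw [map_add, smul_add, ha, hb]

theorem smul_tensorProduct_injective {f : R} (hf : f ∈ nonZeroDivisors R) :
    Function.Injective (fun y : R ⊗[k] K => f • y) := by
  have hinj : Function.Injective (LinearMap.mulLeft k f) := fun a b hab =>
    (mul_cancel_left_mem_nonZeroDivisors hf).1 hab
  have := Module.Flat.rTensor_preserves_injective_linearMap (M := K) _ hinj
  intro a b hab
  exact this (by simpa only [rTensor_mulLeft_apply] using hab)

theorem exists_smul_eq_of_map_mk_eq_zero (f : R) {x : R ⊗[k] K}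
    (hx : Algebra.TensorProduct.map (Ideal.Quotient.mkₐ k (Ideal.span ({f} : Set R)))
      (AlgHom.id k K) x = 0) :
    ∃ y : R ⊗[k] K, f • y = x := by
  have hex : Function.Exact (LinearMap.mulLeft k f)
      (Ideal.Quotient.mkₐ k (Ideal.span ({f} : Set R))).toLinearMap := by
    intro a
    simp [Ideal.Quotient.eq_zero_iff_mem, Ideal.mem_span_singleton, dvd_def, eq_comm (a := a)]
  obtain ⟨y, hy⟩ := (rTensor_exact K hex (Ideal.Quotient.mkₐ_surjective k _) x).1 hx
  exact ⟨y, by rw [← rTensor_mulLeft_apply, hy]⟩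

/-- Reducedness of `R ⊗ K` can be tested modulo a nonzerodivisor in the maximal ideal of `R`. -/
theorem isReduced_tensorProduct_of_quotient_span_singleton [IsNoetherianRing R] [IsLocalRing R]
    [Module.Finite k K] {f : R} (hf : f ∈ IsLocalRing.maximalIdeal R)
    (hnzd : f ∈ nonZeroDivisors R) [IsReduced ((R ⧸ Ideal.span ({f} : Set R)) ⊗[k] K)] :
    IsReduced (R ⊗[k] K) := by
  let N : Submodule R (R ⊗[k] K) := (nilradical (R ⊗[k] K)).restrictScalars R
  have hN : N ≤ Ideal.span ({f} : Set R) • N := by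
    intro x hx
    have hx' : IsNilpotent x := hx
    obtain ⟨y, rfl⟩ := exists_smul_eq_of_map_mk_eq_zero f (hx'.map _).eq_zero
    refine Submodule.smul_mem_smul (Ideal.mem_span_singleton_self f) ?_
    obtain ⟨n, hn⟩ := hx'
    refine ⟨n, smul_tensorProduct_injective (pow_mem hnzd n) ?_⟩
    simpa only [smul_pow, smul_zero] using hn
  have hbot : N = ⊥ := by
    refine Submodule.eq_bot_of_le_smul_of_le_jacobson_bot _ N (IsNoetherian.noetherian N) hN ?_
    rw [IsLocalRing.jacobson_eq_maximalIdeal _ bot_ne_top, Ideal.span_singleton_le_iff_mem]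
    exact hf
  refine ⟨fun x hx => ?_⟩
  have hxN : x ∈ N := hx
  simpa [hbot] using hxN

end


/-- Let `k` be a field, `R` a Noetherian local `k`-algebra, and `f ∈ R` a nonzerodivisor
contained in the maximal ideal of `R`.  If `R/(f)` is geometrically reduced over `k`
(i.e. `K ⊗_k (R/(f))` is reduced for every finite field extension `K/k`), then `R` is
geometrically reduced over `k` (i.e. `K ⊗_k R` is reduced for every finite field
extension `K/k`). -/
theorem stmt_2.{u, v} (k : Type u) [Field k] (R : Type v) [CommRing R]
    [IsNoetherianRing R] [IsLocalRing R] [Algebra k R]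
    (f : R) (hf : f ∈ IsLocalRing.maximalIdeal R) (hnzd : f ∈ nonZeroDivisors R)
    (hred : ∀ (K : Type u) [Field K] [Algebra k K] [Module.Finite k K],
      IsReduced (TensorProduct k K (R ⧸ Ideal.span ({f} : Set R)))) :
    ∀ (K : Type u) [Field K] [Algebra k K] [Module.Finite k K],
      IsReduced (TensorProduct k K R) := by
  intro K _ _ _
  have := hred K
  have : IsReduced ((R ⧸ Ideal.span ({f} : Set R)) ⊗[k] K) :=
    isReduced_of_injective _ (Algebra.TensorProduct.comm k _ K).injective
  have := isReduced_tensorProduct_of_quotient_span_singleton (k := k) (K := K) hf hnzd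
  exact isReduced_of_injective _ (Algebra.TensorProduct.comm k K R).injective
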